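/- For every non-initial rule of the labeled calculus G3Kt and every instance of that rule, all premises of the instance are labeled polytree sequents if and only if the conclusion of the instance is a labeled polytree sequent. -/

import Mathlib

set_option linter.unusedVariables false

/-- Formulae of the tense language `L`. -/
inductive Fm : Type where
  | atom : Nat → Fm
  | top : Fm
  | bot : Fm
  | neg : Fm → Fm
  | or : Fm → Fm → Fm
  | and : Fm → Fm → Fm
  | imp : Fm → Fm → Fm
  | box : Fm → Fm
  | dia : Fm → Fm
  | boxP : Fm → Fm
  | diaP : Fm → Fm
deriving DecidableEq

instance : Inhabited Fm := ⟨Fm.top⟩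

/-- Labeled sequents `R, Γ ⇒ Δ`: a set of relational atoms together with multisets of
labeled formulae on the left and on the right. -/
structure LSeq : Type where
  rel : Finset (Nat × Nat)
  ant : Multiset (Nat × Fm)
  suc : Multiset (Nat × Fm)

/-- The empty labeled sequent. -/
def LSeq.empty : LSeq := ⟨∅, 0, 0⟩
instance : Inhabited LSeq := ⟨LSeq.empty⟩

/-- Sequent composition `⊗`. -/
def LSeq.comp (s t : LSeq) : LSeq := ⟨s.rel ∪ t.rel, s.ant + t.ant, s.suc + t.suc⟩

/-- The labeled sequent `w : A ⇒ ∅`. -/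
def Fq (w : Nat) (A : Fm) : LSeq := ⟨∅, {(w, A)}, 0⟩
/-- The labeled sequent `∅ ⇒ w : A`. -/
def Gq (w : Nat) (A : Fm) : LSeq := ⟨∅, 0, {(w, A)}⟩
/-- The labeled sequent `Rwu ⇒ ∅`. -/
def Rl (w u : Nat) : LSeq := ⟨{(w, u)}, 0, 0⟩

/-- The labels occurring in a labeled sequent. -/
def LSeq.labels (s : LSeq) : Finset Nat :=
  s.rel.image Prod.fst ∪ s.rel.image Prod.snd ∪
    (s.ant.map Prod.fst).toFinset ∪ (s.suc.map Prod.fst).toFinset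

/-- The length `|R| + |Γ| + |Δ|` of a labeled sequent. -/
def LSeq.len (s : LSeq) : Nat := s.rel.card + Multiset.card s.ant + Multiset.card s.suc

/-- Applying a label substitution to a labeled sequent. -/
def LSeq.rename (f : Nat → Nat) (s : LSeq) : LSeq :=
  ⟨s.rel.image (fun e => (f e.1, f e.2)),
   s.ant.map (fun x => (f x.1, x.2)),
   s.suc.map (fun x => (f x.1, x.2))⟩

/-- The (undirected simple) graph of a labeled sequent: labels as vertices, and an edge
between `a` and `b` for each relational atom `Rab`. -/
def LSeq.graph (s : LSeq) : SimpleGraph Nat :=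
  SimpleGraph.fromRel (fun a b => (a, b) ∈ s.rel)

/-- `s` is a labeled polytree sequent: (1) if `R = ∅` then `s` is `w`-flat for some `w`;
(2) if `R ≠ ∅` then every label of `Γ, Δ` occurs in `R`; (3) the graph of `s` is connected
and free of directed and undirected cycles. -/
def IsPolytree (s : LSeq) : Prop :=
  (s.rel = ∅ → ∃ w, (∀ x ∈ s.ant, x.1 = w) ∧ (∀ x ∈ s.suc, x.1 = w)) ∧
  (s.rel ≠ ∅ →
    (∀ x ∈ s.ant, x.1 ∈ s.rel.image Prod.fst ∪ s.rel.image Prod.snd) ∧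
    (∀ x ∈ s.suc, x.1 ∈ s.rel.image Prod.fst ∪ s.rel.image Prod.snd)) ∧
  (∀ a, (a, a) ∉ s.rel) ∧
  (∀ a b, (a, b) ∈ s.rel → (b, a) ∉ s.rel) ∧
  s.graph.IsAcyclic ∧
  (∀ a ∈ s.labels, ∀ b ∈ s.labels, s.graph.Reachable a b)

/-- Isomorphism of labeled sequents: a bijection between the label sets preserving and
reflecting relational atoms and labeled formulae on each side. -/
def LSeq.Iso (s t : LSeq) : Prop :=
  ∃ f : Nat → Nat, Set.BijOn f ↑s.labels ↑t.labels ∧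
    (∀ a b, (a, b) ∈ s.rel → (f a, f b) ∈ t.rel) ∧
    (∀ a b, a ∈ s.labels → b ∈ s.labels → (f a, f b) ∈ t.rel → (a, b) ∈ s.rel) ∧
    (∀ a A, (a, A) ∈ s.ant → (f a, A) ∈ t.ant) ∧
    (∀ a A, a ∈ s.labels → (f a, A) ∈ t.ant → (a, A) ∈ s.ant) ∧
    (∀ a A, (a, A) ∈ s.suc → (f a, A) ∈ t.suc) ∧
    (∀ a A, a ∈ s.labels → (f a, A) ∈ t.suc → (a, A) ∈ s.suc)

/-- The non-initial rules of the labeled calculus `G3Kt`, given as a relation between the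
list of premises and the conclusion. -/
inductive G3Step : List LSeq → LSeq → Prop where
  | negL (w : Nat) (A : Fm) (c : LSeq) :
      G3Step [(Gq w A).comp c] ((Fq w (.neg A)).comp c)
  | negR (w : Nat) (A : Fm) (c : LSeq) :
      G3Step [(Fq w A).comp c] ((Gq w (.neg A)).comp c)
  | andL (w : Nat) (A B : Fm) (c : LSeq) :
      G3Step [(Fq w A).comp ((Fq w B).comp c)] ((Fq w (.and A B)).comp c)
  | andR (w : Nat) (A B : Fm) (c : LSeq) :
      G3Step [(Gq w A).comp c, (Gq w B).comp c] ((Gq w (.and A B)).comp c)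
  | orL (w : Nat) (A B : Fm) (c : LSeq) :
      G3Step [(Fq w A).comp c, (Fq w B).comp c] ((Fq w (.or A B)).comp c)
  | orR (w : Nat) (A B : Fm) (c : LSeq) :
      G3Step [(Gq w A).comp ((Gq w B).comp c)] ((Gq w (.or A B)).comp c)
  | impL (w : Nat) (A B : Fm) (c : LSeq) :
      G3Step [(Gq w A).comp c, (Fq w B).comp c] ((Fq w (.imp A B)).comp c)
  | impR (w : Nat) (A B : Fm) (c : LSeq) :
      G3Step [(Fq w A).comp ((Gq w B).comp c)] ((Gq w (.imp A B)).comp c)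
  | diaL (w u : Nat) (A : Fm) (c : LSeq) :
      u ∉ ((Fq w (.dia A)).comp c).labels →
      G3Step [(Rl w u).comp ((Fq u A).comp c)] ((Fq w (.dia A)).comp c)
  | diaPL (w u : Nat) (A : Fm) (c : LSeq) :
      u ∉ ((Fq w (.diaP A)).comp c).labels →
      G3Step [(Rl u w).comp ((Fq u A).comp c)] ((Fq w (.diaP A)).comp c)
  | boxR (w u : Nat) (A : Fm) (c : LSeq) :
      u ∉ ((Gq w (.box A)).comp c).labels →
      G3Step [(Rl w u).comp ((Gq u A).comp c)] ((Gq w (.box A)).comp c)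
  | boxPR (w u : Nat) (A : Fm) (c : LSeq) :
      u ∉ ((Gq w (.boxP A)).comp c).labels →
      G3Step [(Rl u w).comp ((Gq u A).comp c)] ((Gq w (.boxP A)).comp c)
  | boxL (w u : Nat) (A : Fm) (c : LSeq) :
      G3Step [(Rl w u).comp ((Fq w (.box A)).comp ((Fq u A).comp c))]
        ((Rl w u).comp ((Fq w (.box A)).comp c))
  | boxPL (w u : Nat) (A : Fm) (c : LSeq) :
      G3Step [(Rl u w).comp ((Fq w (.boxP A)).comp ((Fq u A).comp c))]
        ((Rl u w).comp ((Fq w (.boxP A)).comp c))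
  | diaR (w u : Nat) (A : Fm) (c : LSeq) :
      G3Step [(Rl w u).comp ((Gq u A).comp ((Gq w (.dia A)).comp c))]
        ((Rl w u).comp ((Gq w (.dia A)).comp c))
  | diaPR (w u : Nat) (A : Fm) (c : LSeq) :
      G3Step [(Rl u w).comp ((Gq u A).comp ((Gq w (.diaP A)).comp c))]
        ((Rl u w).comp ((Gq w (.diaP A)).comp c))

theorem LSeq.mem_labels {s : LSeq} {a : Nat} :
    a ∈ s.labels ↔ (∃ b, (a, b) ∈ s.rel) ∨ (∃ b, (b, a) ∈ s.rel) ∨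
      (∃ A, (a, A) ∈ s.ant) ∨ ∃ A, (a, A) ∈ s.suc := by
  simp [LSeq.labels]

theorem mem_labels_of_mem_rel {s : LSeq} {a b : Nat} (h : (a, b) ∈ s.rel) :
    a ∈ s.labels ∧ b ∈ s.labels :=
  ⟨LSeq.mem_labels.mpr (.inl ⟨b, h⟩), LSeq.mem_labels.mpr (.inr (.inl ⟨a, h⟩))⟩

/-- The flatness and label-occurrence conditions on a polytree sequent follow from the
connectedness of its labels. -/
theorem isPolytree_iff (s : LSeq) :
    IsPolytree s ↔ (∀ a, (a, a) ∉ s.rel) ∧ (∀ a b, (a, b) ∈ s.rel → (b, a) ∉ s.rel) ∧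
      s.graph.IsAcyclic ∧ ∀ a ∈ s.labels, ∀ b ∈ s.labels, s.graph.Reachable a b := by
  have hant : ∀ x ∈ s.ant, x.1 ∈ s.labels := fun x hx =>
    LSeq.mem_labels.mpr (.inr (.inr (.inl ⟨x.2, hx⟩)))
  have hsuc : ∀ x ∈ s.suc, x.1 ∈ s.labels := fun x hx =>
    LSeq.mem_labels.mpr (.inr (.inr (.inr ⟨x.2, hx⟩)))
  refine ⟨fun h => h.2.2, fun h => ⟨fun he => ?_, fun hne => ?_, h⟩⟩
  · have hbot : s.graph = ⊥ := by
      ext a b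
      simp [LSeq.graph, he]
    have heq : ∀ a ∈ s.labels, ∀ b ∈ s.labels, a = b := by
      simpa [hbot, SimpleGraph.reachable_bot] using h.2.2.2
    by_cases hl : s.labels.Nonempty
    · obtain ⟨w, hw⟩ := hl
      exact ⟨w, fun x hx => heq _ (hant x hx) _ hw, fun x hx => heq _ (hsuc x hx) _ hw⟩
    · exact ⟨0, fun x hx => absurd ⟨x.1, hant x hx⟩ hl, fun x hx => absurd ⟨x.1, hsuc x hx⟩ hl⟩
  · obtain ⟨⟨a, b⟩, hab⟩ := Finset.nonempty_iff_ne_empty.mpr hne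
    have ha : a ∈ s.rel.image Prod.fst ∪ s.rel.image Prod.snd :=
      Finset.mem_union_left _ (Finset.mem_image_of_mem Prod.fst hab)
    have key : ∀ x ∈ s.labels, x ∈ s.rel.image Prod.fst ∪ s.rel.image Prod.snd := by
      intro x hx
      obtain ⟨p⟩ := h.2.2.2 x hx a (mem_labels_of_mem_rel hab).1
      cases p with
      | nil => exact ha
      | cons hadj _ =>
        rcases (SimpleGraph.fromRel_adj _ _ _).mp hadj with ⟨-, hr | hr⟩
        · exact Finset.mem_union_left _ (Finset.mem_image_of_mem Prod.fst hr)
        · exact Finset.mem_union_right _ (Finset.mem_image_of_mem Prod.snd hr)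
    exact ⟨fun x hx => key _ (hant x hx), fun x hx => key _ (hsuc x hx)⟩

theorem isPolytree_congr {s t : LSeq} (hr : s.rel = t.rel) (hl : s.labels = t.labels) :
    IsPolytree s ↔ IsPolytree t := by
  simp only [isPolytree_iff, LSeq.graph, hr, hl]

/-- Attaching a new leaf `u` to a label `w` preserves and reflects being a polytree. -/
theorem isPolytree_leaf_iff {s t : LSeq} {w u x y : Nat} (hxy : (x = w ∧ y = u) ∨ (x = u ∧ y = w))
    (hr : t.rel = insert (x, y) s.rel) (hl : t.labels = insert u s.labels)
    (hw : w ∈ s.labels) (hu : u ∉ s.labels) :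
    IsPolytree t ↔ IsPolytree s := by
  have hfresh : ∀ a, (a, u) ∉ s.rel ∧ (u, a) ∉ s.rel := fun a =>
    ⟨fun h => hu (mem_labels_of_mem_rel h).2, fun h => hu (mem_labels_of_mem_rel h).1⟩
  have hwu : w ≠ u := fun h => hu (h ▸ hw)
  have hadj : ∀ a b, t.graph.Adj a b ↔
      s.graph.Adj a b ∨ (a = w ∧ b = u) ∨ (a = u ∧ b = w) := by
    intro a b
    simp only [LSeq.graph, SimpleGraph.fromRel_adj, hr, Finset.mem_insert, Prod.mk.injEq]
    grind
  have hisol : ∀ a, ¬ s.graph.Adj u a := by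
    intro a ha
    rcases (SimpleGraph.fromRel_adj _ _ _).mp ha with ⟨-, h | h⟩
    · exact (hfresh a).2 h
    · exact (hfresh a).1 h
  have hle : s.graph ≤ t.graph := fun a b h => (hadj a b).mpr (.inl h)
  have hgraph : t.graph = s.graph ⊔ SimpleGraph.edge w u := by
    ext a b
    simp only [hadj, SimpleGraph.sup_adj, SimpleGraph.edge_adj]
    grind
  have hretract : ∀ a b, t.graph.Reachable a b →
      s.graph.Reachable (if a = u then w else a) (if b = u then w else b) := by
    rintro a b ⟨p⟩
    induction p with
    | nil => exact .refl _
    | cons h _ ih =>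
      refine .trans ?_ ih
      rcases (hadj _ _).mp h with h | ⟨rfl, rfl⟩ | ⟨rfl, rfl⟩
      · split_ifs with ha hb hb
        · exact .refl _
        · exact absurd (ha ▸ h) (hisol _)
        · exact absurd (hb ▸ h.symm) (hisol _)
        · exact h.reachable
      · simp
      · simp
  have hnot : ¬ s.graph.Reachable w u := by
    rintro ⟨p⟩
    cases p.reverse with
    | nil => exact hwu rfl
    | cons h _ => exact hisol _ h
  have hloop : (∀ a, (a, a) ∉ t.rel) ↔ ∀ a, (a, a) ∉ s.rel := by
    simp only [hr, Finset.mem_insert, Prod.mk.injEq]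
    grind
  have hasymm : (∀ a b, (a, b) ∈ t.rel → (b, a) ∉ t.rel) ↔
      ∀ a b, (a, b) ∈ s.rel → (b, a) ∉ s.rel := by
    simp only [hr, Finset.mem_insert, Prod.mk.injEq]
    grind
  have hacyc : t.graph.IsAcyclic ↔ s.graph.IsAcyclic := by
    rw [hgraph]
    exact SimpleGraph.isAcyclic_add_edge_iff_of_not_reachable w u hnot
  have hreach : (∀ a ∈ t.labels, ∀ b ∈ t.labels, t.graph.Reachable a b) ↔
      ∀ a ∈ s.labels, ∀ b ∈ s.labels, s.graph.Reachable a b := by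
    constructor
    · intro h a ha b hb
      have := hretract a b (h a (hl ▸ Finset.mem_insert_of_mem ha) b
        (hl ▸ Finset.mem_insert_of_mem hb))
      rwa [if_neg (ne_of_mem_of_not_mem ha hu), if_neg (ne_of_mem_of_not_mem hb hu)] at this
    · intro h
      have hroot : ∀ a ∈ t.labels, t.graph.Reachable a w := by
        intro a ha
        rcases Finset.mem_insert.mp (hl ▸ ha) with rfl | ha
        · exact ((hadj _ _).mpr (.inr (.inr ⟨rfl, rfl⟩))).reachable
        · exact (h a ha w hw).mono hle
      exact fun a ha b hb => (hroot a ha).trans (hroot b hb).symm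
  rw [isPolytree_iff, isPolytree_iff, hloop, hasymm, hacyc, hreach]

theorem LSeq.labels_comp (s t : LSeq) : (s.comp t).labels = s.labels ∪ t.labels := by
  ext a
  simp only [LSeq.mem_labels, LSeq.comp, Finset.mem_union, Multiset.mem_add, exists_or]
  tauto

theorem labels_Fq (w : Nat) (A : Fm) : (Fq w A).labels = {w} := by
  simp [LSeq.labels, Fq]

theorem labels_Gq (w : Nat) (A : Fm) : (Gq w A).labels = {w} := by
  simp [LSeq.labels, Gq]

theorem labels_Rl (w u : Nat) : (Rl w u).labels = {w, u} := by
  ext a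
  simp [LSeq.labels, Rl]

/-- For every instance of a non-initial rule of `G3Kt`, all premises are
labeled polytree sequents if and only if the conclusion is a labeled polytree sequent. -/
theorem g3kt_polytree_iff (prems : List LSeq) (concl : LSeq) (h : G3Step prems concl) :
    (∀ s ∈ prems, IsPolytree s) ↔ IsPolytree concl := by
  cases h with
  | andR w A B c | orL w A B c | impL w A B c =>
    simp only [List.forall_mem_cons, List.not_mem_nil, false_implies, implies_true, and_true]
    refine (and_congr (isPolytree_congr ?_ ?_) (isPolytree_congr ?_ ?_)).trans and_self_iff <;>
      first
      | rfl
      | simp only [LSeq.labels_comp, labels_Fq, labels_Gq]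
  | diaL w u A c hu | boxR w u A c hu =>
    simp only [List.forall_mem_singleton]
    refine isPolytree_leaf_iff (w := w) (.inl ⟨rfl, rfl⟩) ?_ ?_ ?_ hu
    · simp [LSeq.comp, Rl, Fq, Gq]
    all_goals grind [LSeq.labels_comp, labels_Fq, labels_Gq, labels_Rl]
  | diaPL w u A c hu | boxPR w u A c hu =>
    simp only [List.forall_mem_singleton]
    refine isPolytree_leaf_iff (w := w) (.inr ⟨rfl, rfl⟩) ?_ ?_ ?_ hu
    · simp [LSeq.comp, Rl, Fq, Gq]
    all_goals grind [LSeq.labels_comp, labels_Fq, labels_Gq, labels_Rl]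
  | _ =>
    simp only [List.forall_mem_singleton]
    refine isPolytree_congr ?_ ?_
    · simp [LSeq.comp, Rl, Fq, Gq]
    · grind [LSeq.labels_comp, labels_Fq, labels_Gq, labels_Rl]
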